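/- Let ζ(r,n) = n^{−1/2}/(52r²). Then no infinite family of megastars is up-to-ζ fixating; that is, for every infinite set F ⊆ ℤ_{≥1}³ of parameter triples, the family of (k,ℓ,m)-megastars with (k,ℓ,m)∈F is not up-to-ζ fixating. -/

import Mathlib

open Finset

/-- Total fitness of the mutant set `S` (mutants have fitness `r`, non-mutants fitness `1`). -/
noncomputable def moranW {V : Type*} [Fintype V] (r : ℝ) (S : Finset V) : ℝ :=
  r * S.card + ((Fintype.card V : ℝ) - S.card)

/-- One-step transition probability of the Moran process with fitness `r` and
reproduction weights `w`, from mutant set `S` to mutant set `T`:  a vertex `u` is chosen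
with probability `r / moranW r S` if it is a mutant and `1 / moranW r S` otherwise, then a
target `v` is chosen with probability `w u v`, and `v` becomes a mutant if `u` is one and
a non-mutant otherwise. -/
noncomputable def moranStep {V : Type*} [Fintype V] [DecidableEq V]
    (r : ℝ) (w : V → V → ℝ) (S T : Finset V) : ℝ :=
  ∑ u : V, ∑ v : V,
    ((if u ∈ S then r else 1) / moranW r S) * w u v *
      (if (if u ∈ S then insert v S else S.erase v) = T then 1 else 0)

/-- Distribution of the Moran process after `t` steps, from initial distribution `init`. -/
noncomputable def moranDist {V : Type*} [Fintype V] [DecidableEq V]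
    (r : ℝ) (w : V → V → ℝ) (init : Finset V → ℝ) : ℕ → Finset V → ℝ
  | 0 => init
  | t + 1 => fun T => ∑ S : Finset V, moranDist r w init t S * moranStep r w S T

/-- Reproduction weights of the (unweighted) Moran process on the digraph with
out-neighbourhoods `out`: the offspring goes to a uniformly random out-neighbour. -/
noncomputable def outWeights {V : Type*} [DecidableEq V]
    (out : V → Finset V) : V → V → ℝ :=
  fun u v => if v ∈ out u then ((out u).card : ℝ)⁻¹ else 0

/-- Extinction probability: `sup_t Pr(S_t = ∅)`. -/
noncomputable def extinctionProb {V : Type*} [Fintype V] [DecidableEq V]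
    (r : ℝ) (w : V → V → ℝ) (init : Finset V → ℝ) : ℝ :=
  ⨆ t : ℕ, moranDist r w init t (∅ : Finset V)

/-- Fixation probability: `sup_t Pr(S_t = V)`. -/
noncomputable def fixationProb {V : Type*} [Fintype V] [DecidableEq V]
    (r : ℝ) (w : V → V → ℝ) (init : Finset V → ℝ) : ℝ :=
  ⨆ t : ℕ, moranDist r w init t (Finset.univ : Finset V)

/-- Initial distribution: a single mutant at a uniformly random vertex. -/
noncomputable def uniformSingleton (V : Type*) [Fintype V] [DecidableEq V] :
    Finset V → ℝ :=
  fun S => if S.card = 1 then (Fintype.card V : ℝ)⁻¹ else 0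

/-- Initial distribution: a single mutant at the fixed vertex `x₀`. -/
def pointInit {V : Type*} [DecidableEq V] (x₀ : V) : Finset V → ℝ :=
  fun S => if S = {x₀} then 1 else 0

/-- Vertices of the `(k,ℓ,m)`-megastar: `ℓ` reservoirs `R_i` of size `m`
(`Sum.inl (i, x)`), `ℓ` feeder vertices `a_i` (`Sum.inr (Sum.inl i)`), `ℓ` cliques `K_i`
of size `k` (`Sum.inr (Sum.inr (Sum.inl (i, x)))`), and the centre vertex `v*`
(`Sum.inr (Sum.inr (Sum.inr ()))`).  It has `1 + ℓ * (m + 1 + k)` vertices. -/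
abbrev MegastarV (k ℓ m : ℕ) : Type :=
  (Fin ℓ × Fin m) ⊕ (Fin ℓ ⊕ ((Fin ℓ × Fin k) ⊕ Unit))

/-- Out-neighbourhoods of the `(k,ℓ,m)`-megastar: the centre points to every reservoir
vertex, each vertex of `R_i` points to `a_i`, each `a_i` points to every vertex of `K_i`,
the vertices within each clique `K_i` are pairwise connected in both directions, and every
clique vertex points to the centre. -/
def megastarOut (k ℓ m : ℕ) : MegastarV k ℓ m → Finset (MegastarV k ℓ m)
  | Sum.inl (i, _) => {Sum.inr (Sum.inl i)}
  | Sum.inr (Sum.inl i) =>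
      (Finset.univ : Finset (Fin k)).image fun x => Sum.inr (Sum.inr (Sum.inl (i, x)))
  | Sum.inr (Sum.inr (Sum.inl (i, x))) =>
      (((Finset.univ : Finset (Fin k)).erase x).image
          fun y => Sum.inr (Sum.inr (Sum.inl (i, y)))) ∪
        {Sum.inr (Sum.inr (Sum.inr ()))}
  | Sum.inr (Sum.inr (Sum.inr _)) =>
      (Finset.univ : Finset (Fin ℓ × Fin m)).image fun p => Sum.inl p

/-- The family of `(k,ℓ,m)`-megastars with parameter triples in `F` is up-to-`ζ`
fixating: for every `r > 1` there is an `n₀` such that every megastar in the family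
with `n ≥ n₀` vertices has extinction probability at most `ζ r n` for the Moran process
with fitness `r` started from a single uniformly random initial mutant. -/
def UpToZetaFixatingMegastars (ζ : ℝ → ℕ → ℝ) (F : Set (ℕ × ℕ × ℕ)) : Prop :=
  ∀ r : ℝ, 1 < r → ∃ n₀ : ℕ, ∀ k ℓ m : ℕ, (k, ℓ, m) ∈ F →
    n₀ ≤ 1 + ℓ * (m + 1 + k) →
    extinctionProb r (outWeights (megastarOut k ℓ m))
        (uniformSingleton (MegastarV k ℓ m)) ≤
      ζ r (1 + ℓ * (m + 1 + k))

/-- Action of the one-step kernel on functions. -/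
noncomputable def moranOp {V : Type*} [Fintype V] [DecidableEq V]
    (r : ℝ) (w : V → V → ℝ) (g : Finset V → ℝ) (S : Finset V) : ℝ :=
  ∑ u : V, ∑ v : V, ((if u ∈ S then r else 1) / moranW r S) * w u v *
    g (if u ∈ S then insert v S else S.erase v)

section General

variable {V : Type*} [Fintype V] [DecidableEq V]

theorem sum_moranStep (r : ℝ) (w : V → V → ℝ) (g : Finset V → ℝ) (S : Finset V) :
    ∑ T : Finset V, moranStep r w S T * g T = moranOp r w g S := by
  unfold moranStep moranOp
  simp_rw [Finset.sum_mul]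
  rw [Finset.sum_comm]
  refine Finset.sum_congr rfl fun u _ => ?_
  rw [Finset.sum_comm]
  refine Finset.sum_congr rfl fun v _ => ?_
  rw [Finset.sum_eq_single (if u ∈ S then insert v S else S.erase v)]
  · simp
  · intro T _ hT
    rw [if_neg (Ne.symm hT)]
    ring
  · simp

theorem moranW_pos [Nonempty V] {r : ℝ} (hr : 1 < r) (S : Finset V) : 0 < moranW r S := by
  unfold moranW
  have h2 : (0 : ℝ) < Fintype.card V := by exact_mod_cast Fintype.card_pos
  have h1 : (0 : ℝ) ≤ S.card := by positivity
  nlinarith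

theorem sum_fit (r : ℝ) (S : Finset V) :
    ∑ u : V, (if u ∈ S then r else 1) = moranW r S := by
  unfold moranW
  rw [Finset.sum_ite]
  have : (Finset.univ.filter fun u => u ∉ S) = Sᶜ := by ext; simp
  rw [this]
  simp [Finset.card_compl, Nat.cast_sub (Finset.card_le_univ S)]
  ring

theorem moranOp_const [Nonempty V] {r : ℝ} (hr : 1 < r) {w : V → V → ℝ}
    (hw1 : ∀ u, ∑ v, w u v = 1) (c : ℝ) (S : Finset V) :
    moranOp r w (fun _ => c) S = c := by
  unfold moranOp
  simp_rw [← Finset.sum_mul, ← Finset.mul_sum, hw1, mul_one, ← Finset.sum_div, sum_fit]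
  rw [div_self (moranW_pos hr S).ne', one_mul]

theorem moranOp_mono [Nonempty V] {r : ℝ} (hr : 1 < r) {w : V → V → ℝ}
    (hw0 : ∀ u v, 0 ≤ w u v) {f g : Finset V → ℝ} (h : ∀ S, f S ≤ g S) (S : Finset V) :
    moranOp r w f S ≤ moranOp r w g S := by
  unfold moranOp
  refine Finset.sum_le_sum fun u _ => Finset.sum_le_sum fun v _ => ?_
  refine mul_le_mul_of_nonneg_left (h _) (mul_nonneg (div_nonneg ?_ (moranW_pos hr S).le) (hw0 u v))
  split_ifs <;> linarith

/-- `extT t S` is the probability of extinction within `t` steps from `S`. -/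
noncomputable def extT (r : ℝ) (w : V → V → ℝ) : ℕ → Finset V → ℝ
  | 0 => fun S => if S = ∅ then 1 else 0
  | t + 1 => moranOp r w (extT r w t)

theorem moranDist_eq (r : ℝ) (w : V → V → ℝ) (init : Finset V → ℝ) (t : ℕ) (g : Finset V → ℝ) :
    ∑ S : Finset V, moranDist r w init (t + 1) S * g S =
      ∑ S : Finset V, moranDist r w init t S * moranOp r w g S := by
  simp only [moranDist]
  simp_rw [Finset.sum_mul]
  rw [Finset.sum_comm]
  refine Finset.sum_congr rfl fun S _ => ?_
  rw [← sum_moranStep, Finset.mul_sum]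
  exact Finset.sum_congr rfl fun T _ => by ring

theorem moranDist_dual (r : ℝ) (w : V → V → ℝ) (init : Finset V → ℝ) (t s : ℕ) :
    ∑ S : Finset V, moranDist r w init t S * extT r w s S =
      ∑ S : Finset V, init S * extT r w (t + s) S := by
  induction t generalizing s with
  | zero => simp [moranDist]
  | succ t ih =>
    rw [moranDist_eq]
    have := ih (s + 1)
    rw [show t + 1 + s = t + (s + 1) by ring, ← this]
    rfl

theorem moranDist_empty (r : ℝ) (w : V → V → ℝ) (init : Finset V → ℝ) (t : ℕ) :
    moranDist r w init t ∅ = ∑ S : Finset V, init S * extT r w t S := by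
  have := moranDist_dual r w init t 0
  simpa [extT] using this

variable [Nonempty V] {r : ℝ} {w : V → V → ℝ}

theorem extT_nonneg (hr : 1 < r) (hw0 : ∀ u v, 0 ≤ w u v) (hw1 : ∀ u, ∑ v, w u v = 1)
    (t : ℕ) (S : Finset V) : 0 ≤ extT r w t S := by
  induction t generalizing S with
  | zero => simp only [extT]; split_ifs <;> norm_num
  | succ t ih =>
    rw [← moranOp_const hr hw1 0 S]
    exact moranOp_mono hr hw0 ih S

theorem extT_le_one (hr : 1 < r) (hw0 : ∀ u v, 0 ≤ w u v) (hw1 : ∀ u, ∑ v, w u v = 1)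
    (t : ℕ) (S : Finset V) : extT r w t S ≤ 1 := by
  induction t generalizing S with
  | zero => simp only [extT]; split_ifs <;> norm_num
  | succ t ih =>
    rw [← moranOp_const hr hw1 1 S]
    exact moranOp_mono hr hw0 ih S

theorem extT_one_empty (hr : 1 < r) (hw1 : ∀ u, ∑ v, w u v = 1) :
    extT r w 1 (∅ : Finset V) = 1 := by
  rw [← moranOp_const hr hw1 1 (∅ : Finset V)]
  simp [extT, moranOp]

theorem extT_mono (hr : 1 < r) (hw0 : ∀ u v, 0 ≤ w u v) (hw1 : ∀ u, ∑ v, w u v = 1)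
    (S : Finset V) : Monotone fun t => extT r w t S := by
  refine monotone_nat_of_le_succ fun t => ?_
  induction t generalizing S with
  | zero =>
    by_cases h : S = ∅
    · subst h
      rw [zero_add, extT_one_empty hr hw1]
      exact extT_le_one hr hw0 hw1 _ _
    · have : extT r w 0 S = 0 := by simp [extT, h]
      rw [this]
      exact extT_nonneg hr hw0 hw1 _ _
  | succ t ih => exact moranOp_mono hr hw0 ih S

/-- Limit extinction probability. -/
noncomputable def extL (r : ℝ) (w : V → V → ℝ) (S : Finset V) : ℝ := ⨆ t, extT r w t S

theorem extT_tendsto (hr : 1 < r) (hw0 : ∀ u v, 0 ≤ w u v) (hw1 : ∀ u, ∑ v, w u v = 1)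
    (S : Finset V) :
    Filter.Tendsto (fun t => extT r w t S) Filter.atTop (nhds (extL r w S)) := by
  refine tendsto_atTop_ciSup (extT_mono hr hw0 hw1 S) ⟨1, ?_⟩
  rintro _ ⟨t, rfl⟩
  exact extT_le_one hr hw0 hw1 t S

theorem extL_nonneg (hr : 1 < r) (hw0 : ∀ u v, 0 ≤ w u v) (hw1 : ∀ u, ∑ v, w u v = 1)
    (S : Finset V) : 0 ≤ extL r w S :=
  ge_of_tendsto' (extT_tendsto hr hw0 hw1 S) fun t => extT_nonneg hr hw0 hw1 t S

theorem extL_empty (hr : 1 < r) (hw0 : ∀ u v, 0 ≤ w u v) (hw1 : ∀ u, ∑ v, w u v = 1) :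
    extL r w (∅ : Finset V) = 1 := by
  apply le_antisymm
  · exact le_of_tendsto' (extT_tendsto hr hw0 hw1 ∅) fun t => extT_le_one hr hw0 hw1 t ∅
  · have := (extT_mono hr hw0 hw1 (∅ : Finset V)).ge_of_tendsto (extT_tendsto hr hw0 hw1 ∅) 0
    simpa [extT] using this

theorem extL_fix (hr : 1 < r) (hw0 : ∀ u v, 0 ≤ w u v) (hw1 : ∀ u, ∑ v, w u v = 1)
    (S : Finset V) : extL r w S = moranOp r w (extL r w) S := by
  refine tendsto_nhds_unique ((Filter.tendsto_add_atTop_iff_nat 1).2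
    (extT_tendsto hr hw0 hw1 S)) ?_
  simp only [extT, moranOp]
  refine tendsto_finsetSum _ fun u _ => tendsto_finsetSum _ fun v _ => ?_
  exact (extT_tendsto hr hw0 hw1 _).const_mul _

theorem extL_eqn (hr : 1 < r) (hw0 : ∀ u v, 0 ≤ w u v) (hw1 : ∀ u, ∑ v, w u v = 1)
    (S : Finset V) : moranW r S * extL r w S =
      ∑ u ∈ S, r * ∑ v, w u v * extL r w (insert v S) +
        ∑ u ∈ Sᶜ, ∑ v, w u v * extL r w (S.erase v) := by
  conv_lhs => rw [extL_fix hr hw0 hw1 S]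
  unfold moranOp
  rw [← Finset.sum_add_sum_compl S, mul_add, Finset.mul_sum, Finset.mul_sum]
  have hW := (moranW_pos hr S).ne'
  congr 1
  · refine Finset.sum_congr rfl fun u hu => ?_
    rw [Finset.mul_sum, Finset.mul_sum]
    refine Finset.sum_congr rfl fun v _ => ?_
    simp only [hu, if_true]
    field_simp
  · refine Finset.sum_congr rfl fun u hu => ?_
    rw [Finset.mul_sum]
    refine Finset.sum_congr rfl fun v _ => ?_
    simp only [Finset.mem_compl.1 hu, if_false]
    field_simp

theorem extinctionProb_eq (hr : 1 < r) (hw0 : ∀ u v, 0 ≤ w u v) (hw1 : ∀ u, ∑ v, w u v = 1)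
    {init : Finset V → ℝ} (hi : ∀ S, 0 ≤ init S) :
    extinctionProb r w init = ∑ S, init S * extL r w S := by
  unfold extinctionProb
  simp_rw [moranDist_empty]
  refine tendsto_nhds_unique
    (f := fun t => ∑ S, init S * extT r w t S) (tendsto_atTop_ciSup ?_ ?_) ?_
  · intro s t hst
    exact Finset.sum_le_sum fun S _ =>
      mul_le_mul_of_nonneg_left (extT_mono hr hw0 hw1 S hst) (hi S)
  · refine ⟨∑ S, init S * 1, ?_⟩
    rintro _ ⟨t, rfl⟩
    exact Finset.sum_le_sum fun S _ =>
      mul_le_mul_of_nonneg_left (extT_le_one hr hw0 hw1 t S) (hi S)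
  · exact tendsto_finsetSum _ fun S _ => (extT_tendsto hr hw0 hw1 S).const_mul _

theorem extinctionProb_uniform (hr : 1 < r) (hw0 : ∀ u v, 0 ≤ w u v)
    (hw1 : ∀ u, ∑ v, w u v = 1) :
    extinctionProb r w (uniformSingleton V) =
      (Fintype.card V : ℝ)⁻¹ * ∑ x : V, extL r w {x} := by
  rw [extinctionProb_eq hr hw0 hw1]
  · unfold uniformSingleton
    simp_rw [ite_mul, zero_mul]
    rw [← Finset.sum_filter, Finset.mul_sum]
    symm
    refine Finset.sum_bij (fun x _ => ({x} : Finset V)) ?_ ?_ ?_ ?_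
    · intro a _; simp
    · intro a _ b _ h; simpa using h
    · intro S hS
      obtain ⟨a, rfl⟩ := Finset.card_eq_one.1 (Finset.mem_filter.1 hS).2
      exact ⟨a, by simp, rfl⟩
    · intro a _; rfl
  · intro S
    unfold uniformSingleton
    split_ifs <;> positivity

theorem sum_erase_one (hr : 1 < r) (hw0 : ∀ u v, 0 ≤ w u v) (hw1 : ∀ u, ∑ v, w u v = 1)
    (x u : V) : ∑ v, w u v * extL r w (({x} : Finset V).erase v) =
      w u x + (1 - w u x) * extL r w {x} := by
  have h : ∀ v, w u v * extL r w (({x} : Finset V).erase v) =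
      w u v * extL r w {x} + (if v = x then w u x * (1 - extL r w {x}) else 0) := by
    intro v
    split_ifs with h
    · subst h; simp [extL_empty hr hw0 hw1]; ring
    · rw [Finset.erase_eq_of_notMem (by simpa using h)]; ring
  simp_rw [h, Finset.sum_add_distrib, ← Finset.sum_mul, hw1]
  simp
  ring

theorem single_eqn (hr : 1 < r) (hw0 : ∀ u v, 0 ≤ w u v) (hw1 : ∀ u, ∑ v, w u v = 1)
    (x : V) : (r + ∑ u ∈ ({x} : Finset V)ᶜ, w u x) * extL r w {x} =
      (∑ u ∈ ({x} : Finset V)ᶜ, w u x) + r * ∑ v, w x v * extL r w {v, x} := by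
  have h := extL_eqn hr hw0 hw1 ({x} : Finset V)
  simp_rw [sum_erase_one hr hw0 hw1] at h
  rw [Finset.sum_add_distrib, ← Finset.sum_mul, Finset.sum_sub_distrib] at h
  simp only [Finset.sum_singleton, moranW, Finset.card_singleton, Finset.sum_const,
    Finset.card_compl, nsmul_eq_mul, Nat.cast_sub (Fintype.card_pos (α := V)), Nat.cast_one] at h
  linear_combination h

theorem single_lower (hr : 1 < r) (hw0 : ∀ u v, 0 ≤ w u v) (hw1 : ∀ u, ∑ v, w u v = 1)
    (x : V) (hx : 1 ≤ ∑ u ∈ ({x} : Finset V)ᶜ, w u x) : 1 / (r + 1) ≤ extL r w {x} := by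
  have h := single_eqn hr hw0 hw1 x
  have h0 : 0 ≤ ∑ v, w x v * extL r w {v, x} :=
    Finset.sum_nonneg fun v _ => mul_nonneg (hw0 _ _) (extL_nonneg hr hw0 hw1 _)
  set I := ∑ u ∈ ({x} : Finset V)ᶜ, w u x
  rw [div_le_iff₀ (by linarith)]
  by_contra hc
  push Not at hc
  have hp := extL_nonneg hr hw0 hw1 ({x} : Finset V)
  have h1 : (r + I) * extL r w {x} ≥ I := by nlinarith
  nlinarith

theorem sum_erase_two (hr : 1 < r) (hw0 : ∀ u v, 0 ≤ w u v) (hw1 : ∀ u, ∑ v, w u v = 1)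
    {x a : V} (hxa : a ≠ x) (u : V) :
    w u a * extL r w {x} + (1 - w u a - w u x) * extL r w {a, x} ≤
    ∑ v, w u v * extL r w (({a, x} : Finset V).erase v) := by
  have h : ∀ v, w u v * extL r w {a, x} +
      ((if v = a then w u a * (extL r w {x} - extL r w {a, x}) else 0) +
       (if v = x then w u x * (- extL r w {a, x}) else 0)) ≤
      w u v * extL r w (({a, x} : Finset V).erase v) := by
    intro v
    by_cases h1 : v = a
    · subst h1
      rw [if_pos rfl, if_neg hxa, Finset.erase_insert (by simpa using hxa)]
      apply le_of_eq; ring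
    · rw [if_neg h1]
      by_cases h2 : v = x
      · subst h2
        rw [if_pos rfl]
        have := mul_nonneg (hw0 u v) (extL_nonneg hr hw0 hw1 (({a, v} : Finset V).erase v))
        linarith
      · rw [if_neg h2, Finset.erase_eq_of_notMem (by simp [h1, h2])]
        simp
  refine le_trans (le_of_eq ?_) (Finset.sum_le_sum fun v _ => h v)
  simp_rw [Finset.sum_add_distrib, ← Finset.sum_mul, hw1]
  simp
  ring

theorem pair_ineq (hr : 1 < r) (hw0 : ∀ u v, 0 ≤ w u v) (hw1 : ∀ u, ∑ v, w u v = 1)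
    {x a : V} (hxa : a ≠ x) (hwx : ∀ v, w x v = if v = a then 1 else 0) :
    (∑ u ∈ ({a, x} : Finset V)ᶜ, w u a) * extL r w {x} ≤
    (r + (∑ u ∈ ({a, x} : Finset V)ᶜ, w u a) + ∑ u ∈ ({a, x} : Finset V)ᶜ, w u x)
      * extL r w {a, x} := by
  have h := extL_eqn hr hw0 hw1 ({a, x} : Finset V)
  have h2 := Finset.sum_le_sum fun u (_ : u ∈ ({a, x} : Finset V)ᶜ) =>
    sum_erase_two hr hw0 hw1 hxa u
  have h3 : 0 ≤ ∑ v, w a v * extL r w (insert v {a, x}) :=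
    Finset.sum_nonneg fun v _ => mul_nonneg (hw0 _ _) (extL_nonneg hr hw0 hw1 _)
  have h4 : ∑ v, w x v * extL r w (insert v {a, x}) = extL r w {a, x} := by
    simp [hwx]
  rw [Finset.sum_pair hxa, h4] at h
  rw [Finset.sum_add_distrib, ← Finset.sum_mul, ← Finset.sum_mul, Finset.sum_sub_distrib,
    Finset.sum_sub_distrib] at h2
  have hc2 : 2 ≤ Fintype.card V := by
    rw [← Finset.card_pair hxa]; exact Finset.card_le_univ _
  simp only [moranW, Finset.card_pair hxa, Finset.sum_const,
    Finset.card_compl, nsmul_eq_mul, Nat.cast_sub hc2] at h h2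
  push_cast at h h2
  have h5 : 0 ≤ r * ∑ v, w a v * extL r w (insert v {a, x}) := mul_nonneg (by linarith) h3
  nlinarith

end General

section Mega

variable {k ℓ m : ℕ}

abbrev mR (p : Fin ℓ × Fin m) : MegastarV k ℓ m := Sum.inl p
abbrev mA (i : Fin ℓ) : MegastarV k ℓ m := Sum.inr (Sum.inl i)
abbrev mK (p : Fin ℓ × Fin k) : MegastarV k ℓ m := Sum.inr (Sum.inr (Sum.inl p))
abbrev mC : MegastarV k ℓ m := Sum.inr (Sum.inr (Sum.inr ()))

noncomputable abbrev mW (k ℓ m : ℕ) := outWeights (megastarOut k ℓ m)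

theorem card_out_K (p : Fin ℓ × Fin k) : (megastarOut k ℓ m (mK p)).card = k := by
  obtain ⟨i, x⟩ := p
  have hk : 0 < k := x.pos
  simp only [megastarOut]
  rw [Finset.card_union_of_disjoint (by simp), Finset.card_image_of_injective]
  · simp; omega
  · intro a b h; simpa using h

theorem card_out_A (i : Fin ℓ) : (megastarOut k ℓ m (mA i)).card = k := by
  simp only [megastarOut]
  rw [Finset.card_image_of_injective]
  · simp
  · intro a b h; simpa using h

theorem card_out_C : (megastarOut k ℓ m mC).card = ℓ * m := by
  simp only [megastarOut]
  rw [Finset.card_image_of_injective]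
  · simp
  · intro a b h; simpa using h

theorem card_out_R (p : Fin ℓ × Fin m) : (megastarOut k ℓ m (mR p)).card = 1 := by
  obtain ⟨i, x⟩ := p
  simp [megastarOut]

theorem mW_nonneg (u v : MegastarV k ℓ m) : 0 ≤ mW k ℓ m u v := by
  unfold mW outWeights
  split_ifs <;> positivity

theorem mW_sum (hk : 1 ≤ k) (hl : 1 ≤ ℓ) (hm : 1 ≤ m) (u : MegastarV k ℓ m) :
    ∑ v, mW k ℓ m u v = 1 := by
  have hc : (megastarOut k ℓ m u).card ≠ 0 := by
    rcases u with p | i | p | c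
    · rw [card_out_R]; omega
    · rw [card_out_A]; omega
    · rw [card_out_K]; omega
    · rw [card_out_C]; positivity
  unfold mW outWeights
  rw [Finset.sum_ite_mem]
  simp only [Finset.univ_inter, Finset.sum_const, nsmul_eq_mul]
  exact mul_inv_cancel₀ (by exact_mod_cast hc)

theorem in_A (hm : 1 ≤ m) (i : Fin ℓ) :
    1 ≤ ∑ u ∈ ({mA i} : Finset (MegastarV k ℓ m))ᶜ, mW k ℓ m u (mA i) := by
  have h : mW k ℓ m (mR (i, ⟨0, hm⟩)) (mA i) = 1 := by
    simp [mW, outWeights, megastarOut]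
  rw [← h]
  exact Finset.single_le_sum (f := fun u => mW k ℓ m u (mA i))
    (fun u _ => mW_nonneg u _) (by simp)

theorem in_K (p : Fin ℓ × Fin k) :
    1 ≤ ∑ u ∈ ({mK p} : Finset (MegastarV k ℓ m))ᶜ, mW k ℓ m u (mK p) := by
  obtain ⟨i, x⟩ := p
  have hk : 0 < k := x.pos
  have hcA := card_out_A (k := k) (m := m) i
  let T : Finset (MegastarV k ℓ m) := insert (mA i) (((Finset.univ : Finset (Fin k)).erase x).image
          fun y => mK (i, y))
  have hsub : T ⊆ ({mK (i, x)} : Finset (MegastarV k ℓ m))ᶜ := by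
    intro u hu
    simp only [T, Finset.mem_insert, Finset.mem_image, Finset.mem_erase] at hu
    rcases hu with rfl | ⟨y, ⟨hy, _⟩, rfl⟩ <;> simp [*]
  refine le_trans ?_ (Finset.sum_le_sum_of_subset_of_nonneg hsub fun u _ _ => mW_nonneg u _)
  have hc : T.card = k := by
    simp only [T]
    rw [Finset.card_insert_of_notMem (by simp), Finset.card_image_of_injective]
    · simp; omega
    · intro a b h; simpa using h
  have hv : ∀ u ∈ T, mW k ℓ m u (mK (i, x)) = (k : ℝ)⁻¹ := by
    intro u hu
    simp only [T, Finset.mem_insert, Finset.mem_image, Finset.mem_erase] at hu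
    rcases hu with rfl | ⟨y, ⟨hy, _⟩, rfl⟩
    · unfold mW outWeights
      rw [card_out_A, if_pos (by simp [megastarOut])]
    · unfold mW outWeights
      rw [card_out_K, if_pos (by simp [megastarOut, Ne.symm hy])]
  rw [Finset.sum_congr rfl hv, Finset.sum_const, hc, nsmul_eq_mul]
  exact (mul_inv_cancel₀ (by positivity)).ge

theorem w_R_in (p : Fin ℓ × Fin m) (u : MegastarV k ℓ m) :
    mW k ℓ m u (mR p) = if u = mC then ((ℓ * m : ℕ) : ℝ)⁻¹ else 0 := by
  unfold mW outWeights
  rcases u with ⟨j, y⟩ | j | ⟨j, y⟩ | c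
  · simp [megastarOut]
  · simp [megastarOut]
  · simp [megastarOut]
  · rw [if_pos rfl, card_out_C, if_pos (by simp [megastarOut])]

theorem w_R_out (i : Fin ℓ) (x : Fin m) (v : MegastarV k ℓ m) :
    mW k ℓ m (mR (i, x)) v = if v = mA i then 1 else 0 := by
  unfold mW outWeights
  rw [card_out_R]
  simp [megastarOut]

theorem w_A_in (i : Fin ℓ) :
    ∑ u, mW k ℓ m u (mA i) = m := by
  simp only [Fintype.sum_sum_type, Fintype.sum_prod_type]
  simp [mW, outWeights, megastarOut]

theorem ext_R (hk : 1 ≤ k) (hl : 1 ≤ ℓ) (hm : 1 ≤ m) (p : Fin ℓ × Fin m) :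
    1 / (7 * (ℓ : ℝ)) ≤ extL 2 (mW k ℓ m) {mR p} := by
  obtain ⟨i, x⟩ := p
  have hr : (1 : ℝ) < 2 := by norm_num
  have hw1 := mW_sum hk hl hm
  have h1 := single_eqn hr mW_nonneg hw1 (mR (i, x))
  have h2 := pair_ineq (x := mR (i, x)) (a := mA i) hr mW_nonneg hw1 (by simp) (w_R_out i x)
  have s1 : ∑ u ∈ ({mR (i, x)} : Finset (MegastarV k ℓ m))ᶜ, mW k ℓ m u (mR (i, x)) =
      ((ℓ * m : ℕ) : ℝ)⁻¹ := by
    simp_rw [w_R_in]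
    rw [Finset.sum_ite_eq']
    simp
  have s2 : ∑ u ∈ ({mA i, mR (i, x)} : Finset (MegastarV k ℓ m))ᶜ, mW k ℓ m u (mR (i, x)) =
      ((ℓ * m : ℕ) : ℝ)⁻¹ := by
    simp_rw [w_R_in]
    rw [Finset.sum_ite_eq']
    simp
  have s3 : ∑ u ∈ ({mA i, mR (i, x)} : Finset (MegastarV k ℓ m))ᶜ, mW k ℓ m u (mA i) =
      (m : ℝ) - 1 := by
    have h := Finset.sum_add_sum_compl ({mA i, mR (i, x)} : Finset (MegastarV k ℓ m))
      fun u => mW k ℓ m u (mA i)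
    rw [w_A_in, Finset.sum_pair (by simp), w_R_out, if_pos rfl] at h
    have h0 : mW k ℓ m (mA i) (mA i) = 0 := by simp [mW, outWeights, megastarOut]
    rw [h0] at h
    linarith
  have s4 : ∑ v, mW k ℓ m (mR (i, x)) v * extL 2 (mW k ℓ m) {v, mR (i, x)} =
      extL 2 (mW k ℓ m) {mA i, mR (i, x)} := by
    simp_rw [w_R_out]
    simp
  rw [s1, s4] at h1
  rw [s2, s3] at h2
  have hp := extL_nonneg hr mW_nonneg hw1 ({mR (i, x)} : Finset (MegastarV k ℓ m))
  have hq := extL_nonneg hr mW_nonneg hw1 ({mA i, mR (i, x)} : Finset (MegastarV k ℓ m))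
  generalize extL 2 (mW k ℓ m) {mR (i, x)} = P at *
  generalize extL 2 (mW k ℓ m) {mA i, mR (i, x)} = Q at *
  have hL : (1 : ℝ) ≤ ℓ := by exact_mod_cast hl
  have hM : (1 : ℝ) ≤ m := by exact_mod_cast hm
  push_cast at h1 h2
  generalize (ℓ : ℝ) = L at *
  generalize (m : ℝ) = M at *
  have hd : ((L * M)⁻¹) * L * M = 1 := by field_simp
  have hd0 : 0 < (L * M)⁻¹ := by positivity
  generalize (L * M)⁻¹ = d at *
  rw [div_le_iff₀ (by positivity)]
  have hd1 : d ≤ 1 := by nlinarith [mul_nonneg (sub_nonneg.2 hL) (sub_nonneg.2 hM)]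
  -- (2+d) P = d + 2 Q,  (M-1) P ≤ (1+M+d) Q
  have h3 : d * (1 + M + d) ≤ P * (d * (1 + M + d) + 2 * (2 + d)) := by
    nlinarith
  have h4 : d * (1 + M + d) + 2 * (2 + d) ≤ 7 * L * (d * (1 + M + d)) := by
    have e1 : L * d * (1 + M + d) ≥ 1 := by nlinarith [mul_pos hd0 (by linarith : 0 < L)]
    have e2 : d * (1 + M + d) ≤ L * d * (1 + M + d) := by
      have : 0 ≤ d * (1 + M + d) := by positivity
      nlinarith
    nlinarith
  have hX : 0 < d * (1 + M + d) := by positivity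
  have h5 : d * (1 + M + d) ≤ P * (7 * L * (d * (1 + M + d))) :=
    h3.trans (mul_le_mul_of_nonneg_left h4 hp)
  nlinarith

theorem mega_lower (hk : 1 ≤ k) (hl : 1 ≤ ℓ) (hm : 1 ≤ m) :
    ((1 + ℓ * (m + 1 + k) : ℕ) : ℝ)⁻¹ * ((m : ℝ) / 7 + ℓ * (k + 1) / 3) ≤
    extinctionProb 2 (mW k ℓ m) (uniformSingleton (MegastarV k ℓ m)) := by
  have hr : (1 : ℝ) < 2 := by norm_num
  have hw1 := mW_sum hk hl hm
  rw [extinctionProb_uniform hr mW_nonneg hw1]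
  have hcard : Fintype.card (MegastarV k ℓ m) = 1 + ℓ * (m + 1 + k) := by
    simp; ring
  rw [hcard]
  refine mul_le_mul_of_nonneg_left ?_ (by positivity)
  rw [Fintype.sum_sum_type, Fintype.sum_sum_type, Fintype.sum_sum_type]
  have a1 : ∑ p : Fin ℓ × Fin m, 1 / (7 * (ℓ : ℝ)) ≤
      ∑ p : Fin ℓ × Fin m, extL 2 (mW k ℓ m) {mR p} :=
    Finset.sum_le_sum fun p _ => ext_R hk hl hm p
  have a2 : ∑ i : Fin ℓ, 1 / ((2 : ℝ) + 1) ≤ ∑ i : Fin ℓ, extL 2 (mW k ℓ m) {mA i} :=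
    Finset.sum_le_sum fun i _ => single_lower hr mW_nonneg hw1 _ (in_A hm i)
  have a3 : ∑ p : Fin ℓ × Fin k, 1 / ((2 : ℝ) + 1) ≤
      ∑ p : Fin ℓ × Fin k, extL 2 (mW k ℓ m) {mK p} :=
    Finset.sum_le_sum fun p _ => single_lower hr mW_nonneg hw1 _ (in_K p)
  have a4 : 0 ≤ ∑ c : Unit, extL 2 (mW k ℓ m) {Sum.inr (Sum.inr (Sum.inr c))} :=
    Finset.sum_nonneg fun c _ => extL_nonneg hr mW_nonneg hw1 _
  simp only [Finset.sum_const, Finset.card_univ, Fintype.card_prod, Fintype.card_fin,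
    nsmul_eq_mul] at a1 a2 a3
  push_cast at a1 a2 a3
  have hL : (0 : ℝ) < ℓ := by exact_mod_cast hl
  have e1 : (ℓ : ℝ) * m * (1 / (7 * ℓ)) = m / 7 := by field_simp
  rw [e1] at a1
  linarith

end Mega

/-- **No megastar family amplifies substantially better than `Υ_M`** (Theorem 1.11).
Let `ζ(r,n) = n^{-1/2}/(52r²)`.  Then no infinite family of megastars is up-to-`ζ`
fixating. -/
theorem no_megastar_family_up_to_zeta_fixating
    (F : Set (ℕ × ℕ × ℕ)) (hF : F.Infinite)
    (hF1 : ∀ p ∈ F, 1 ≤ p.1 ∧ 1 ≤ p.2.1 ∧ 1 ≤ p.2.2) :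
    ¬ UpToZetaFixatingMegastars
        (fun r n => (n : ℝ) ^ (-(1 : ℝ) / 2) / (52 * r ^ 2)) F := by
  intro h
  obtain ⟨n₀, hn⟩ := h 2 (by norm_num)
  have hex : ∃ p ∈ F, n₀ ≤ 1 + p.2.1 * (p.2.2 + 1 + p.1) := by
    by_contra hc
    push Not at hc
    apply hF
    refine Set.Finite.subset
      ((Finset.range (n₀ + 1) ×ˢ (Finset.range (n₀ + 1) ×ˢ Finset.range (n₀ + 1))).finite_toSet) ?_
    rintro ⟨k, ℓ, m⟩ hp
    have h1 := hc _ hp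
    obtain ⟨hk, hl, hm⟩ := hF1 _ hp
    simp only at h1 hk hl hm
    have h2 : m + 1 + k ≤ ℓ * (m + 1 + k) := Nat.le_mul_of_pos_left _ hl
    have h3 : ℓ ≤ ℓ * (m + 1 + k) := Nat.le_mul_of_pos_right _ (by omega)
    simp
    omega
  obtain ⟨⟨k, ℓ, m⟩, hp, hn0⟩ := hex
  obtain ⟨hk, hl, hm⟩ := hF1 _ hp
  simp only at hn0 hk hl hm
  have h1 := (mega_lower hk hl hm).trans (hn k ℓ m hp hn0)
  have hL : (1 : ℝ) ≤ ℓ := by exact_mod_cast hl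
  have hM : (1 : ℝ) ≤ m := by exact_mod_cast hm
  have hK : (1 : ℝ) ≤ k := by exact_mod_cast hk
  have hN : ((1 + ℓ * (m + 1 + k) : ℕ) : ℝ) = 1 + ℓ * m + ℓ * (k + 1) := by push_cast; ring
  simp only at h1
  rw [hN] at h1
  clear hN
  have hLM : (1 : ℝ) ≤ ℓ * m := by nlinarith
  have hLK : (2 : ℝ) * ℓ ≤ ℓ * (k + 1) := by nlinarith
  generalize (ℓ : ℝ) * (k + 1) = B at *
  generalize (ℓ : ℝ) = L at *
  generalize (m : ℝ) = M at *
  obtain ⟨s, hs0, hs⟩ : ∃ s : ℝ, 0 < s ∧ 1 + L * M + B = s ^ 2 :=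
    ⟨√(1 + L * M + B), by apply Real.sqrt_pos.2; linarith,
      (Real.sq_sqrt (by linarith)).symm⟩
  rw [hs] at h1
  have hpow : (s ^ 2) ^ (-(1 : ℝ) / 2) = s⁻¹ := by
    rw [← Real.rpow_natCast, ← Real.rpow_mul hs0.le]
    norm_num
    exact Real.rpow_neg_one s
  rw [hpow] at h1
  have h2 : M / 7 + B / 3 ≤ s / 208 := by
    have := mul_le_mul_of_nonneg_left h1 (sq_nonneg s)
    field_simp at this
    linarith
  have hB : B ≤ 3 * s / 208 := by linarith
  have hM2 : M ≤ 7 * s / 208 := by linarith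
  have hL2 : L ≤ 3 * s / 416 := by linarith
  have hLM2 : L * M ≤ (3 * s / 416) * (7 * s / 208) :=
    mul_le_mul hL2 hM2 (by linarith) (by positivity)
  have hs1 : 2 ≤ s := by nlinarith
  nlinarith
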